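/- Let A and B be finite groups, ρ a finite-dimensional complex representation of A on V, and ψ a finite-dimensional complex representation of B on W, and let ρ⊗ψ denote the representation of A×B on V⊗W given by (a,b)·(v⊗w) = (av)⊗(bw). Then lcm(α(ρ), α(ψ)) divides α(ρ⊗ψ), and α(ρ⊗ψ) divides α(ρ)·α(ψ). -/

import Mathlib

namespace AlphaChar

variable {G : Type*} [Group G] {V : Type*} [AddCommMonoid V] [Module ℂ V]

/-- The cardinality of the orbit of a vector `v` under the linear action of `G` via `ρ`. -/
noncomputable def orbitCard (ρ : Representation ℂ G V) (v : V) : ℕ :=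
  Nat.card (Set.range fun g : G => ρ g v)

open Classical in
/-- The α-characteristic of a representation: the gcd of the cardinalities of the orbits
of all nonzero vectors. -/
noncomputable def alphaChar [Finite G] (ρ : Representation ℂ G V) : ℕ :=
  ((Finset.range (Nat.card G + 1)).filter
    (fun n => ∃ v : V, v ≠ 0 ∧ orbitCard ρ v = n)).gcd id

/-- A representation is nontrivial if some group element acts as a non-identity operator. -/
def IsNontrivial (ρ : Representation ℂ G V) : Prop := ∃ g : G, ρ g ≠ 1

/-- A representation is irreducible if the space is nonzero and the only invariant
subspaces are `⊥` and `⊤`. -/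
def IsIrreducible (ρ : Representation ℂ G V) : Prop :=
  Nontrivial V ∧
    ∀ U : Submodule ℂ V, (∀ (g : G) (v : V), v ∈ U → ρ g v ∈ U) → U = ⊥ ∨ U = ⊤

end AlphaChar

namespace AlphaChar

open scoped TensorProduct

section Orbits

variable {G H : Type*} [Group G] [Group H] {V W : Type*} [AddCommMonoid V] [Module ℂ V]
  [AddCommMonoid W] [Module ℂ W]

/-- The stabilizer of a vector under a representation. -/
def vectorStabilizer (ρ : Representation ℂ G V) (v : V) : Subgroup G where
  carrier := {g | ρ g v = v}
  one_mem' := by simp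
  mul_mem' {a b} ha hb := by
    simp only [Set.mem_ofPred_eq] at ha hb ⊢
    rw [map_mul, Module.End.mul_apply, hb, ha]
  inv_mem' {a} ha := by
    simp only [Set.mem_ofPred_eq] at ha ⊢
    conv_lhs => rw [← ha]
    simp

@[simp]
theorem mem_vectorStabilizer {ρ : Representation ℂ G V} {v : V} {g : G} :
    g ∈ vectorStabilizer ρ v ↔ ρ g v = v :=
  Iff.rfl

theorem orbitCard_eq_index (ρ : Representation ℂ G V) (v : V) :
    orbitCard ρ v = (vectorStabilizer ρ v).index := by
  let _ : MulAction G V :=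
    { smul := fun g v => ρ g v
      one_smul := fun v => by change ρ 1 v = v; simp
      mul_smul := fun a b v => by change ρ (a * b) v = ρ a (ρ b v); simp }
  exact (MulAction.index_stabilizer G v).symm

theorem orbitCard_dvd_orbitCard {ρ : Representation ℂ G V} {σ : Representation ℂ G W}
    {v : V} {w : W} (h : ∀ g, ρ g v = v → σ g w = w) : orbitCard σ w ∣ orbitCard ρ v := by
  rw [orbitCard_eq_index, orbitCard_eq_index]
  exact Subgroup.index_dvd_of_le h

theorem _root_.Subgroup.relIndex_dvd_index_of_normal_right [Finite G] (S N : Subgroup G)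
    [N.Normal] : S.relIndex N ∣ S.index := by
  obtain ⟨c, hc⟩ := Subgroup.relIndex_dvd_index_of_normal N S
  have h₁ := Subgroup.relIndex_mul_index (inf_le_left : S ⊓ N ≤ S)
  have h₂ := Subgroup.relIndex_mul_index (inf_le_right : S ⊓ N ≤ N)
  rw [Subgroup.inf_relIndex_left] at h₁
  rw [Subgroup.inf_relIndex_right, ← h₁, hc] at h₂
  refine ⟨c, mul_left_cancel₀ (Subgroup.FiniteIndex.index_ne_zero (H := N.subgroupOf S)) ?_⟩
  change N.relIndex S * _ = N.relIndex S * _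
  rw [← h₂]
  ring

theorem orbitCard_comp_dvd [Finite G] (ρ : Representation ℂ G V) (f : H →* G) [f.range.Normal]
    (v : V) : orbitCard (MonoidHom.comp ρ f) v ∣ orbitCard ρ v := by
  rw [orbitCard_eq_index, orbitCard_eq_index]
  change ((vectorStabilizer ρ v).comap f).index ∣ _
  rw [Subgroup.index_comap]
  exact Subgroup.relIndex_dvd_index_of_normal_right _ _

theorem orbitCard_tmul_dvd (ρ : Representation ℂ G V) (ψ : Representation ℂ H W)
    (v : V) (w : W) :
    orbitCard (Representation.tprod (ρ.comp (MonoidHom.fst G H)) (ψ.comp (MonoidHom.snd G H)))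
      (v ⊗ₜ[ℂ] w) ∣ orbitCard ρ v * orbitCard ψ w := by
  rw [orbitCard_eq_index, orbitCard_eq_index, orbitCard_eq_index, ← Subgroup.index_prod]
  refine Subgroup.index_dvd_of_le fun g hg => ?_
  obtain ⟨h₁, h₂⟩ := Subgroup.mem_prod.mp hg
  rw [mem_vectorStabilizer] at h₁ h₂
  simp [h₁, h₂]

variable [Finite G]

theorem alphaChar_dvd_orbitCard (ρ : Representation ℂ G V) {v : V} (hv : v ≠ 0) :
    alphaChar ρ ∣ orbitCard ρ v := by
  classical
  refine Finset.gcd_dvd (f := id) ?_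
  rw [Finset.mem_filter, Finset.mem_range, Nat.lt_succ_iff]
  exact ⟨Finite.card_range_le _, v, hv, rfl⟩

theorem dvd_mul_alphaChar (ρ : Representation ℂ G V) {d n : ℕ}
    (h : ∀ v : V, v ≠ 0 → d ∣ n * orbitCard ρ v) : d ∣ n * alphaChar ρ := by
  classical
  rw [alphaChar, ← normalize_eq n, ← Finset.gcd_mul_left]
  refine Finset.dvd_gcd fun m hm => ?_
  obtain ⟨v, hv, rfl⟩ := (Finset.mem_filter.mp hm).2
  exact h v hv

theorem dvd_alphaChar (ρ : Representation ℂ G V) {d : ℕ}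
    (h : ∀ v : V, v ≠ 0 → d ∣ orbitCard ρ v) : d ∣ alphaChar ρ := by
  simpa using dvd_mul_alphaChar ρ (n := 1) (by simpa using h)

end Orbits

section Contraction

variable {K V W : Type*} [Field K] [AddCommGroup V] [Module K V] [AddCommGroup W] [Module K W]

theorem exists_rTensor_equivariant_apply_ne_zero {x : V ⊗[K] W} (hx : x ≠ 0) :
    ∃ f : V ⊗[K] W →ₗ[K] V, f x ≠ 0 ∧
      ∀ (T : V →ₗ[K] V) (y : V ⊗[K] W), f (T.rTensor W y) = T (f y) := by
  classical
  let b := Module.Basis.ofVectorSpace K W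
  let e := TensorProduct.equivFinsuppOfBasisRight (M := V) b
  obtain ⟨i, hi⟩ := Finsupp.ne_iff.mp (e.map_ne_zero_iff.mpr hx)
  refine ⟨Finsupp.lapply i ∘ₗ e.toLinearMap, hi, fun T y => ?_⟩
  induction y with
  | zero => simp
  | tmul v w => simp [e]
  | add y z hy hz => simp only [map_add, hy, hz]

theorem exists_lTensor_equivariant_apply_ne_zero {x : V ⊗[K] W} (hx : x ≠ 0) :
    ∃ f : V ⊗[K] W →ₗ[K] W, f x ≠ 0 ∧
      ∀ (T : W →ₗ[K] W) (y : V ⊗[K] W), f (T.lTensor V y) = T (f y) := by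
  classical
  let b := Module.Basis.ofVectorSpace K V
  let e := TensorProduct.equivFinsuppOfBasisLeft (N := W) b
  obtain ⟨i, hi⟩ := Finsupp.ne_iff.mp (e.map_ne_zero_iff.mpr hx)
  refine ⟨Finsupp.lapply i ∘ₗ e.toLinearMap, hi, fun T y => ?_⟩
  induction y with
  | zero => simp
  | tmul v w => simp [e]
  | add y z hy hz => simp only [map_add, hy, hz]

theorem tmul_ne_zero {v : V} {w : W} (hv : v ≠ 0) (hw : w ≠ 0) : v ⊗ₜ[K] w ≠ 0 := by
  intro h
  refine hw ((Module.forall_dual_apply_eq_zero_iff K w).mp fun φ => ?_)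
  have := congrArg (TensorProduct.rid K V ∘ LinearMap.lTensor V φ) h
  simpa [hv] using this

end Contraction

instance range_inl_normal {G H : Type*} [Group G] [Group H] :
    (MonoidHom.inl G H).range.Normal := by
  refine ⟨?_⟩
  rintro _ ⟨a, rfl⟩ g
  exact ⟨g.1 * a * g.1⁻¹, by ext <;> simp⟩

instance range_inr_normal {G H : Type*} [Group G] [Group H] :
    (MonoidHom.inr G H).range.Normal := by
  refine ⟨?_⟩
  rintro _ ⟨b, rfl⟩ g
  exact ⟨g.2 * b * g.2⁻¹, by ext <;> simp⟩

end AlphaChar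

open AlphaChar TensorProduct in
/-- lcm(α(ρ), α(ψ)) ∣ α(ρ⊗ψ) and α(ρ⊗ψ) ∣ α(ρ)·α(ψ), where ρ⊗ψ is the
representation of A × B on V ⊗ W given by (a,b)·(v⊗w) = (av)⊗(bw). -/
theorem alphaChar_tprod_dvd {A B : Type} [Group A] [Finite A] [Group B] [Finite B]
    {V W : Type} [AddCommGroup V] [Module ℂ V] [FiniteDimensional ℂ V]
    [AddCommGroup W] [Module ℂ W] [FiniteDimensional ℂ W]
    (ρ : Representation ℂ A V) (ψ : Representation ℂ B W) :
    Nat.lcm (alphaChar ρ) (alphaChar ψ) ∣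
        alphaChar (Representation.tprod (ρ.comp (MonoidHom.fst A B)) (ψ.comp (MonoidHom.snd A B))) ∧
      alphaChar (Representation.tprod (ρ.comp (MonoidHom.fst A B)) (ψ.comp (MonoidHom.snd A B))) ∣
        alphaChar ρ * alphaChar ψ := by
  set τ := Representation.tprod (ρ.comp (MonoidHom.fst A B)) (ψ.comp (MonoidHom.snd A B))
  refine ⟨Nat.lcm_dvd ?_ ?_, ?_⟩
  · refine dvd_alphaChar τ fun x hx => ?_
    obtain ⟨f, hfx, hf⟩ := exists_rTensor_equivariant_apply_ne_zero hx
    refine ((alphaChar_dvd_orbitCard ρ hfx).trans (orbitCard_dvd_orbitCard fun a ha => ?_)).trans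
      (orbitCard_comp_dvd τ (MonoidHom.inl A B) x)
    rw [← hf]
    exact congrArg f (by simpa [τ, LinearMap.rTensor, Module.End.one_eq_id] using ha)
  · refine dvd_alphaChar τ fun x hx => ?_
    obtain ⟨f, hfx, hf⟩ := exists_lTensor_equivariant_apply_ne_zero hx
    refine ((alphaChar_dvd_orbitCard ψ hfx).trans (orbitCard_dvd_orbitCard fun b hb => ?_)).trans
      (orbitCard_comp_dvd τ (MonoidHom.inr A B) x)
    rw [← hf]
    exact congrArg f (by simpa [τ, LinearMap.lTensor, Module.End.one_eq_id] using hb)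
  · refine dvd_mul_alphaChar ψ fun w hw => ?_
    rw [mul_comm]
    refine dvd_mul_alphaChar ρ fun v hv => ?_
    rw [mul_comm]
    exact (alphaChar_dvd_orbitCard τ (tmul_ne_zero hv hw)).trans (orbitCard_tmul_dvd ρ ψ v w)
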